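/- Invariance of the three-parameter metric on the extended Siegel–Jacobi upper half space 𝒳̃^J_n: let α, γ, δ > 0, fix (M,(λ,μ),κ) with M = [[a,b],[c,d]] ∈ Sp(n,ℝ), λ, μ ∈ M(1,n,ℝ), κ ∈ ℝ, and set p := λdᵗ − μcᵗ, q := −λbᵗ + μaᵗ. Let x', y' : ℝ → M(n,ℝ) be differentiable with x'(t) symmetric, y'(t) symmetric positive definite for all t, p', q' : ℝ → M(1,n,ℝ) and κ' : ℝ → ℝ differentiable. Define v₁(t) := (a(x'(t)+iy'(t)) + b)(c(x'(t)+iy'(t)) + d)^{-1}, x₁ := (v₁ + v̄₁)/2, y₁ := (v₁ − v̄₁)/(2i), p₁(t) := p + p'(t)dᵗ − q'(t)cᵗ, q₁(t) := q − p'(t)bᵗ + q'(t)aᵗ, κ₁(t) := κ + κ'(t) + λ·q'(t)ᵗ − μ·p'(t)ᵗ. Then for every t, α·tr[(y₁^{-1}dx₁/dt)² + (y₁^{-1}dy₁/dt)²] + γ·[(dp₁/dt)(x₁y₁^{-1}x₁ + y₁)(dp₁/dt)ᵗ + (dq₁/dt)y₁^{-1}(dq₁/dt)ᵗ + 2(dp₁/dt)x₁y₁^{-1}(dq₁/dt)ᵗ]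 + δ·(dκ₁/dt − p₁(dq₁/dt)ᵗ + q₁(dp₁/dt)ᵗ)² equals the same expression with (x₁,y₁,p₁,q₁,κ₁) replaced by (x',y',p',q',κ'). -/

import Mathlib

open Matrix

/-- The standard symplectic structure matrix `J` with `n×n` blocks `[[0, I],[−I, 0]]`. -/
def Jmat (n : ℕ) : Matrix (Fin n ⊕ Fin n) (Fin n ⊕ Fin n) ℝ :=
  fromBlocks 0 1 (-1) 0

/-- Entrywise derivative of a matrix-valued function of a real variable. -/
noncomputable def mderiv {m k : Type*} (f : ℝ → Matrix m k ℝ) (t : ℝ) : Matrix m k ℝ :=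
  Matrix.of fun i j => deriv (fun s => f s i j) t

/-- The value of the three-parameter metric of the extended Siegel–Jacobi upper half
space `α·tr[(y⁻¹dx)² + (y⁻¹dy)²] + γ·[dp(xy⁻¹x + y)dpᵗ + dq y⁻¹ dqᵗ + 2 dp xy⁻¹ dqᵗ]
+ δ·(dκ − p dqᵗ + q dpᵗ)²` on the tangent vector `(dx, dy, dp, dq, dκ)` at
`(x, y, p, q, κ)`. -/
noncomputable def esjMetric (n : ℕ) (α γ δ : ℝ) (x y dx dy : Matrix (Fin n) (Fin n) ℝ)
    (p q dp dq : Matrix (Fin 1) (Fin n) ℝ) (dκ : ℝ) : ℝ :=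
  α * Matrix.trace (y⁻¹ * dx * (y⁻¹ * dx) + y⁻¹ * dy * (y⁻¹ * dy)) +
  γ * ((dp * (x * y⁻¹ * x + y) * dpᵀ) 0 0 + (dq * y⁻¹ * dqᵀ) 0 0 +
    2 * (dp * (x * y⁻¹) * dqᵀ) 0 0) +
  δ * (dκ - (p * dqᵀ) 0 0 + (q * dpᵀ) 0 0) ^ 2

section Derivative

attribute [local instance] Matrix.linftyOpNormedRing Matrix.linftyOpNormedAlgebra

theorem hasDerivAt_matrix_iff {n : ℕ} {f : ℝ → Matrix (Fin n) (Fin n) ℂ}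
    {f' : Matrix (Fin n) (Fin n) ℂ} {t : ℝ} :
    HasDerivAt f f' t ↔ ∀ i j, HasDerivAt (fun s => f s i j) (f' i j) t := by
  have h : HasDerivAt f f' t ↔ ∀ i, HasDerivAt (fun s => f s i) (f' i) t := hasDerivAt_pi
  rw [h]
  exact forall_congr' fun i => hasDerivAt_pi

theorem hasDerivAt_mobius {n : ℕ} {A B C D w : Matrix (Fin n) (Fin n) ℂ}
    {v : ℝ → Matrix (Fin n) (Fin n) ℂ} {t : ℝ}
    (hv : ∀ i j, HasDerivAt (fun s => v s i j) (w i j) t) (hU : IsUnit (C * v t + D))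
    (i j : Fin n) :
    HasDerivAt (fun s => ((A * v s + B) * (C * v s + D)⁻¹) i j)
      (((A - (A * v t + B) * (C * v t + D)⁻¹ * C) * w * (C * v t + D)⁻¹) i j) t := by
  have hv' := hasDerivAt_matrix_iff.2 hv
  have hN : HasDerivAt (fun s => A * v s + B) (A * w) t := (hv'.const_mul A).add_const B
  have hD : HasDerivAt (fun s => C * v s + D) (C * w) t := (hv'.const_mul C).add_const D
  obtain ⟨u, hu⟩ := hU
  have hinv := hasFDerivAt_ringInverse (𝕜 := ℝ) u
  rw [hu] at hinv
  have h := hN.mul (hinv.comp_hasDerivAt t hD)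
  have hu' : (↑u⁻¹ : Matrix (Fin n) (Fin n) ℂ) = (C * v t + D)⁻¹ := by
    rw [← hu, Matrix.coe_units_inv]
  have hf : ((fun s => A * v s + B) * Ring.inverse ∘ fun s => C * v s + D) =
      fun s => (A * v s + B) * (C * v s + D)⁻¹ := by
    ext1 s
    simp [Matrix.nonsing_inv_eq_ringInverse]
  rw [hf] at h
  refine hasDerivAt_matrix_iff.1 (h.congr_deriv ?_) i j
  simp [hu', ← Matrix.nonsing_inv_eq_ringInverse]
  noncomm_ring

end Derivative

section ComplexMatrix

variable {m n : Type*}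

/-- The complex matrix with real part `x` and imaginary part `y`. -/
noncomputable def complexMatrix (x y : Matrix m n ℝ) : Matrix m n ℂ :=
  x.map Complex.ofReal + Complex.I • y.map Complex.ofReal

theorem map_re_complexMatrix (x y : Matrix m n ℝ) :
    (complexMatrix x y).map Complex.re = x := by
  ext i j
  simp [complexMatrix]

theorem map_im_complexMatrix (x y : Matrix m n ℝ) :
    (complexMatrix x y).map Complex.im = y := by
  ext i j
  simp [complexMatrix]

theorem complexMatrix_re_im (v : Matrix m n ℂ) :
    complexMatrix (v.map Complex.re) (v.map Complex.im) = v := by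
  ext i j
  simp [complexMatrix, mul_comm Complex.I, Complex.re_add_im]

theorem map_conj_complexMatrix (x y : Matrix m n ℝ) :
    (complexMatrix x y).map (starRingEnd ℂ) = complexMatrix x (-y) := by
  ext i j
  simp [complexMatrix]

theorem transpose_complexMatrix (x y : Matrix n n ℝ) :
    (complexMatrix x y)ᵀ = complexMatrix xᵀ yᵀ := by
  ext i j
  simp [complexMatrix]

theorem trace_sq_add_sq [Fintype n] (Z X Y : Matrix n n ℂ) :
    (Z * X * (Z * X) + Z * Y * (Z * Y)).trace =
      (Z * (X + Complex.I • Y) * (Z * (X - Complex.I • Y))).trace := by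
  have h : Z * (X + Complex.I • Y) * (Z * (X - Complex.I • Y)) =
      Z * X * (Z * X) + Z * Y * (Z * Y) +
        Complex.I • (Z * Y * (Z * X) - Z * X * (Z * Y)) := by
    simp only [Matrix.mul_add, Matrix.add_mul, Matrix.mul_sub, Matrix.mul_smul, Matrix.smul_mul,
      smul_add, smul_sub, smul_smul, Complex.I_mul_I, neg_smul, one_smul]
    abel
  rw [h, trace_add _ (Complex.I • _), trace_smul, trace_sub, Matrix.trace_mul_comm (Z * Y) (Z * X),
    sub_self, smul_zero, add_zero]

end ComplexMatrix

section Algebra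

variable {n : Type*} [Fintype n] [DecidableEq n]

theorem map_inv_of_isUnit {R S : Type*} [CommRing R] [CommRing S] (f : R →+* S)
    {M : Matrix n n R} (hM : IsUnit M) : M⁻¹.map f = (M.map f)⁻¹ := by
  refine (Matrix.inv_eq_right_inv ?_).symm
  rw [← Matrix.map_mul, Matrix.mul_nonsing_inv _ ((Matrix.isUnit_iff_isUnit_det _).1 hM)]
  exact Matrix.map_one _ (map_zero f) (map_one f)

variable {R : Type*} [CommRing R] {A B C D v u : Matrix n n R}

theorem mobius_cross_sub (hAC : Aᵀ * C = Cᵀ * A) (hBD : Bᵀ * D = Dᵀ * B)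
    (hAD : Aᵀ * D - Cᵀ * B = 1) (hDA : Dᵀ * A - Bᵀ * C = 1) (hv : vᵀ = v) :
    (A * v + B)ᵀ * (C * u + D) - (C * v + D)ᵀ * (A * u + B) = v - u := by
  have h : (A * v + B)ᵀ * (C * u + D) - (C * v + D)ᵀ * (A * u + B) =
      v * (Aᵀ * C - Cᵀ * A) * u + v * (Aᵀ * D - Cᵀ * B) - (Dᵀ * A - Bᵀ * C) * u +
        (Bᵀ * D - Dᵀ * B) := by
    simp only [transpose_add, transpose_mul, hv]
    noncomm_ring
  rw [h, hAC, hBD, hAD, hDA]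
  simp

/-- The action of a block matrix on a square matrix by linear fractional transformations. -/
noncomputable def mobius (A B C D v : Matrix n n R) : Matrix n n R :=
  (A * v + B) * (C * v + D)⁻¹

theorem mobius_sub (hAC : Aᵀ * C = Cᵀ * A) (hBD : Bᵀ * D = Dᵀ * B)
    (hAD : Aᵀ * D - Cᵀ * B = 1) (hDA : Dᵀ * A - Bᵀ * C = 1) (hv : vᵀ = v)
    (hU : IsUnit (C * v + D)) (hU' : IsUnit (C * u + D)) :
    (mobius A B C D v)ᵀ - mobius A B C D u = ((C * v + D)⁻¹)ᵀ * (v - u) * (C * u + D)⁻¹ := by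
  rw [← mobius_cross_sub (u := u) hAC hBD hAD hDA hv, mobius, mobius, transpose_mul]
  have h1 : (C * u + D) * (C * u + D)⁻¹ = 1 :=
    Matrix.mul_nonsing_inv _ ((Matrix.isUnit_iff_isUnit_det _).1 hU')
  have h2 : ((C * v + D)⁻¹)ᵀ * (C * v + D)ᵀ = 1 := by
    rw [← transpose_mul, Matrix.mul_nonsing_inv _ ((Matrix.isUnit_iff_isUnit_det _).1 hU),
      transpose_one]
  rw [mul_sub, sub_mul, mul_assoc, mul_assoc (_ᵀ), h1, ← mul_assoc (_ᵀ) (_ᵀ) (A * u + B), h2,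
    mul_one, one_mul]

theorem mobius_transpose (hAC : Aᵀ * C = Cᵀ * A) (hBD : Bᵀ * D = Dᵀ * B)
    (hAD : Aᵀ * D - Cᵀ * B = 1) (hDA : Dᵀ * A - Bᵀ * C = 1) (hv : vᵀ = v)
    (hU : IsUnit (C * v + D)) : (mobius A B C D v)ᵀ = mobius A B C D v := by
  simpa [sub_eq_zero] using mobius_sub hAC hBD hAD hDA hv hU hU

theorem sub_mobius_mul (hAC : Aᵀ * C = Cᵀ * A) (hBD : Bᵀ * D = Dᵀ * B)
    (hAD : Aᵀ * D - Cᵀ * B = 1) (hDA : Dᵀ * A - Bᵀ * C = 1) (hv : vᵀ = v)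
    (hU : IsUnit (C * v + D)) : A - mobius A B C D v * C = ((C * v + D)⁻¹)ᵀ := by
  have h2 : ((C * v + D)⁻¹)ᵀ * (C * v + D)ᵀ = 1 := by
    rw [← transpose_mul, Matrix.mul_nonsing_inv _ ((Matrix.isUnit_iff_isUnit_det _).1 hU),
      transpose_one]
  have h3 : (C * v + D)ᵀ * A - (A * v + B)ᵀ * C = 1 := by
    have h : (C * v + D)ᵀ * A - (A * v + B)ᵀ * C =
        (Dᵀ * A - Bᵀ * C) - v * (Aᵀ * C - Cᵀ * A) := by
      simp only [transpose_add, transpose_mul, hv]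
      noncomm_ring
    rw [h, hAC, hDA]
    simp
  rw [← mobius_transpose hAC hBD hAD hDA hv hU, mobius, transpose_mul]
  calc A - ((C * v + D)⁻¹)ᵀ * (A * v + B)ᵀ * C
      = ((C * v + D)⁻¹)ᵀ * (C * v + D)ᵀ * A - ((C * v + D)⁻¹)ᵀ * (A * v + B)ᵀ * C := by
        rw [h2, one_mul]
    _ = ((C * v + D)⁻¹)ᵀ * ((C * v + D)ᵀ * A - (A * v + B)ᵀ * C) := by noncomm_ring
    _ = _ := by rw [h3, mul_one]

theorem row_mul_mobius_add {m : Type*} (hAC : Aᵀ * C = Cᵀ * A) (hBD : Bᵀ * D = Dᵀ * B)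
    (hAD : Aᵀ * D - Cᵀ * B = 1) (hDA : Dᵀ * A - Bᵀ * C = 1)
    (hU : IsUnit (C * v + D)) (p q : Matrix m n R) :
    (p * Dᵀ - q * Cᵀ) * mobius A B C D v + (-(p * Bᵀ) + q * Aᵀ) =
      (p * v + q) * (C * v + D)⁻¹ := by
  have h1 : (C * v + D) * (C * v + D)⁻¹ = 1 :=
    Matrix.mul_nonsing_inv _ ((Matrix.isUnit_iff_isUnit_det _).1 hU)
  have h2 : -(p * Bᵀ) + q * Aᵀ = (-(p * Bᵀ) + q * Aᵀ) * (C * v + D) * (C * v + D)⁻¹ := by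
    rw [Matrix.mul_assoc, h1, Matrix.mul_one]
  rw [h2, mobius, ← Matrix.mul_assoc, ← Matrix.add_mul]
  congr 1
  have h : (p * Dᵀ - q * Cᵀ) * (A * v + B) + (-(p * Bᵀ) + q * Aᵀ) * (C * v + D) =
      p * ((Dᵀ * A - Bᵀ * C) * v) + p * (Dᵀ * B - Bᵀ * D) + q * ((Aᵀ * C - Cᵀ * A) * v) +
        q * (Aᵀ * D - Cᵀ * B) := by
    simp only [Matrix.mul_add, Matrix.add_mul, Matrix.mul_sub, Matrix.sub_mul, Matrix.neg_mul,
      Matrix.mul_assoc]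
    abel
  rw [h, hAC, hBD, hAD, hDA]
  simp

theorem isUnit_of_conjTranspose_mul_sub {U N b : Matrix n n ℂ} {k : ℂ} (hk : k ≠ 0) (hb : IsUnit b)
    (h : Nᴴ * U - Uᴴ * N = k • (bᴴ * b)) : IsUnit U := by
  rw [← Matrix.mulVec_injective_iff_isUnit] at hb
  rw [Matrix.isUnit_iff_isUnit_det, isUnit_iff_ne_zero]
  intro hdet
  obtain ⟨x, hx, hUx⟩ := Matrix.exists_mulVec_eq_zero_iff.2 hdet
  have hz : star x ⬝ᵥ ((Nᴴ * U - Uᴴ * N) *ᵥ x) = 0 := by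
    rw [Matrix.sub_mulVec, dotProduct_sub, ← Matrix.mulVec_mulVec, ← Matrix.mulVec_mulVec, hUx,
      Matrix.dotProduct_mulVec _ Uᴴ, ← Matrix.star_mulVec, hUx]
    simp
  rw [h, Matrix.smul_mulVec, dotProduct_smul, ← Matrix.mulVec_mulVec, Matrix.dotProduct_mulVec,
    ← Matrix.star_mulVec, smul_eq_zero_iff_right hk] at hz
  open scoped ComplexOrder in
  exact hx (hb (by simpa using dotProduct_star_self_eq_zero.1 hz))

theorem row_form_eq {Z X Y : Matrix n n ℂ} (hX : Xᵀ = X) (hY : Yᵀ = Y) (hZ : Zᵀ = Z)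
    (hZY : Z * Y = 1) (hYZ : Y * Z = 1) (p q : Matrix (Fin 1) n ℂ) :
    (p * (X * Z * X + Y) * pᵀ) 0 0 + (q * Z * qᵀ) 0 0 + 2 * (p * (X * Z) * qᵀ) 0 0 =
      ((p * (X + Complex.I • Y) + q) * Z * (p * (X - Complex.I • Y) + q)ᵀ) 0 0 := by
  have hsymm (M : Matrix (Fin 1) (Fin 1) ℂ) : Mᵀ = M := by
    ext i j
    rw [Subsingleton.elim i j, transpose_apply]
  have h1 : q * (Z * (X * pᵀ)) = p * (X * (Z * qᵀ)) := by
    rw [← hsymm (q * _)]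
    simp [transpose_mul, hX, hZ, Matrix.mul_assoc]
  have h2 : q * pᵀ = p * qᵀ := by
    rw [← hsymm (q * _)]
    simp [transpose_mul]
  have hZY' (r : Matrix n (Fin 1) ℂ) : Z * (Y * r) = r := by
    rw [← Matrix.mul_assoc, hZY, Matrix.one_mul]
  have hYZ' (r : Matrix n (Fin 1) ℂ) : Y * (Z * r) = r := by
    rw [← Matrix.mul_assoc, hYZ, Matrix.one_mul]
  have h : (p * (X + Complex.I • Y) + q) * Z * (p * (X - Complex.I • Y) + q)ᵀ =
      p * (X * Z * X + Y) * pᵀ + q * Z * qᵀ + (2 : ℂ) • (p * (X * Z) * qᵀ) := by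
    simp only [transpose_add, transpose_sub, transpose_mul, transpose_smul, hX, hY,
      Matrix.mul_add, Matrix.add_mul, Matrix.mul_sub, Matrix.mul_smul,
      Matrix.smul_mul, Matrix.mul_assoc, hZY', hYZ', h1, h2, smul_add, smul_smul,
      Complex.I_mul_I, two_smul, neg_smul, one_smul]
    abel
  rw [h]
  simp

end Algebra

section Metric

theorem map_ofReal_mul {l m n : Type*} [Fintype m] (M : Matrix l m ℝ) (N : Matrix m n ℝ) :
    (M * N).map Complex.ofReal = M.map Complex.ofReal * N.map Complex.ofReal :=
  Matrix.map_mul (f := Complex.ofRealHom)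

theorem map_ofReal_add {m n : Type*} (M N : Matrix m n ℝ) :
    (M + N).map Complex.ofReal = M.map Complex.ofReal + N.map Complex.ofReal :=
  Matrix.map_add _ Complex.ofReal_add _ _

theorem map_ofReal_sub {m n : Type*} (M N : Matrix m n ℝ) :
    (M - N).map Complex.ofReal = M.map Complex.ofReal - N.map Complex.ofReal :=
  Matrix.map_sub _ Complex.ofReal_sub _ _

theorem map_ofReal_neg {m n : Type*} (M : Matrix m n ℝ) :
    (-M).map Complex.ofReal = -M.map Complex.ofReal := by
  ext i j
  simp

theorem map_ofReal_one {n : Type*} [DecidableEq n] :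
    (1 : Matrix n n ℝ).map Complex.ofReal = 1 :=
  Matrix.map_one _ Complex.ofReal_zero Complex.ofReal_one

theorem map_conj_map_ofReal {m n : Type*} (M : Matrix m n ℝ) :
    (M.map Complex.ofReal).map (starRingEnd ℂ) = M.map Complex.ofReal := by
  ext i j
  simp

variable {n : ℕ}

theorem ofReal_esjMetric {x y : Matrix (Fin n) (Fin n) ℝ} (hx : xᵀ = x) (hy : yᵀ = y)
    (hu : IsUnit y) (α γ δ : ℝ) (dx dy : Matrix (Fin n) (Fin n) ℝ)
    (p q dp dq : Matrix (Fin 1) (Fin n) ℝ) (dκ : ℝ) :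
    (esjMetric n α γ δ x y dx dy p q dp dq dκ : ℂ) =
      α * ((y.map Complex.ofReal)⁻¹ * complexMatrix dx dy *
        ((y.map Complex.ofReal)⁻¹ * complexMatrix dx (-dy))).trace +
      γ * ((dp.map Complex.ofReal * complexMatrix x y + dq.map Complex.ofReal) *
        (y.map Complex.ofReal)⁻¹ *
        (dp.map Complex.ofReal * complexMatrix x (-y) + dq.map Complex.ofReal)ᵀ) 0 0 +
      δ * ((dκ - (p * dqᵀ) 0 0 + (q * dpᵀ) 0 0 : ℝ) : ℂ) ^ 2 := by
  have hneg (M N : Matrix (Fin n) (Fin n) ℝ) : complexMatrix M (-N) =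
      M.map Complex.ofReal - Complex.I • N.map Complex.ofReal := by
    rw [complexMatrix, map_ofReal_neg, smul_neg, sub_eq_add_neg]
  have hent {k : Type} (M : Matrix k k ℝ) (i j : k) : ((M i j : ℝ) : ℂ) =
      M.map Complex.ofReal i j :=
    rfl
  have htr (M : Matrix (Fin n) (Fin n) ℝ) : ((M.trace : ℝ) : ℂ) =
      (M.map Complex.ofReal).trace := by
    simp [trace]
  have hinv : y⁻¹.map Complex.ofReal = (y.map Complex.ofReal)⁻¹ :=
    map_inv_of_isUnit Complex.ofRealHom hu
  have hdet : IsUnit y.det := (Matrix.isUnit_iff_isUnit_det _).1 hu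
  have hZY : (y.map Complex.ofReal)⁻¹ * y.map Complex.ofReal = 1 := by
    rw [← hinv, ← map_ofReal_mul, Matrix.nonsing_inv_mul _ hdet, map_ofReal_one]
  have hYZ : y.map Complex.ofReal * (y.map Complex.ofReal)⁻¹ = 1 := by
    rw [← hinv, ← map_ofReal_mul, Matrix.mul_nonsing_inv _ hdet, map_ofReal_one]
  have hY : (y.map Complex.ofReal)ᵀ = y.map Complex.ofReal := by rw [← transpose_map, hy]
  rw [hneg, hneg, complexMatrix, complexMatrix, ← trace_sq_add_sq,
    ← row_form_eq (by rw [← transpose_map, hx]) hY (by rw [transpose_nonsing_inv, hY]) hZY hYZ,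
    esjMetric]
  simp only [Complex.ofReal_add, Complex.ofReal_mul, Complex.ofReal_pow, Complex.ofReal_ofNat, htr,
    hent (_ * _), map_ofReal_mul, map_ofReal_add, hinv, transpose_map]

variable {a b c d x y : Matrix (Fin n) (Fin n) ℝ}

theorem map_ofReal_symplectic (hac : aᵀ * c = cᵀ * a) (hbd : bᵀ * d = dᵀ * b)
    (had : aᵀ * d - cᵀ * b = 1) (hda : dᵀ * a - bᵀ * c = 1) :
    (a.map Complex.ofReal)ᵀ * c.map Complex.ofReal =
        (c.map Complex.ofReal)ᵀ * a.map Complex.ofReal ∧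
      (b.map Complex.ofReal)ᵀ * d.map Complex.ofReal =
        (d.map Complex.ofReal)ᵀ * b.map Complex.ofReal ∧
      (a.map Complex.ofReal)ᵀ * d.map Complex.ofReal -
        (c.map Complex.ofReal)ᵀ * b.map Complex.ofReal = 1 ∧
      (d.map Complex.ofReal)ᵀ * a.map Complex.ofReal -
        (b.map Complex.ofReal)ᵀ * c.map Complex.ofReal = 1 := by
  simp only [← transpose_map, ← map_ofReal_mul, ← map_ofReal_sub, hac, hbd, had, hda,
    map_ofReal_one, and_self]

/-- The automorphy factor `c v + d` at `v = x + i y`. -/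
noncomputable def automorphyFactor (c d x y : Matrix (Fin n) (Fin n) ℝ) :
    Matrix (Fin n) (Fin n) ℂ :=
  c.map Complex.ofReal * complexMatrix x y + d.map Complex.ofReal

theorem map_conj_automorphyFactor (c d x y : Matrix (Fin n) (Fin n) ℝ) :
    (automorphyFactor c d x y).map (starRingEnd ℂ) = automorphyFactor c d x (-y) := by
  rw [automorphyFactor, Matrix.map_add _ (map_add _), Matrix.map_mul, map_conj_complexMatrix,
    map_conj_map_ofReal, map_conj_map_ofReal, automorphyFactor]

theorem complexMatrix_sub_neg (x y : Matrix (Fin n) (Fin n) ℝ) :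
    complexMatrix x y - complexMatrix x (-y) = (2 * Complex.I) • y.map Complex.ofReal := by
  rw [complexMatrix, complexMatrix, map_ofReal_neg, smul_neg, mul_smul, two_smul]
  abel

theorem isUnit_automorphyFactor (hac : aᵀ * c = cᵀ * a) (hbd : bᵀ * d = dᵀ * b)
    (had : aᵀ * d - cᵀ * b = 1) (hda : dᵀ * a - bᵀ * c = 1) (hx : xᵀ = x) (hy : yᵀ = y)
    (hpd : y.PosDef) : IsUnit (automorphyFactor c d x y) := by
  obtain ⟨hAC, hBD, hAD, hDA⟩ := map_ofReal_symplectic hac hbd had hda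
  have hconj (e f : Matrix (Fin n) (Fin n) ℝ) : (automorphyFactor e f x y)ᴴ =
      (automorphyFactor e f x (-y))ᵀ := by
    rw [← map_conj_automorphyFactor]
    rfl
  have h := mobius_cross_sub (v := complexMatrix x (-y)) (u := complexMatrix x y) hAC hBD hAD hDA
    (by rw [transpose_complexMatrix, transpose_neg, hx, hy])
  rw [← neg_sub (complexMatrix x y), complexMatrix_sub_neg, ← neg_smul] at h
  change (automorphyFactor a b x (-y))ᵀ * automorphyFactor c d x y -
    (automorphyFactor c d x (-y))ᵀ * automorphyFactor a b x y = _ at h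
  rw [← hconj, ← hconj] at h
  obtain ⟨r, hr, rfl⟩ : ∃ r : Matrix (Fin n) (Fin n) ℝ, IsUnit r ∧ y = star r * r := by
    open scoped MatrixOrder Matrix.Norms.L2Operator in
    exact CStarAlgebra.isStrictlyPositive_iff_eq_star_mul_self.mp hpd.isStrictlyPositive
  refine isUnit_of_conjTranspose_mul_sub (N := automorphyFactor a b x (star r * r))
    (b := r.map Complex.ofReal) (k := -(2 * Complex.I)) (by simp)
    (hr.map Complex.ofRealHom.mapMatrix) ?_
  rw [h, map_ofReal_mul]
  congr 2
  ext i j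
  simp [star_eq_conjTranspose]

/-- Pointwise invariance of the metric under the transformation of tangent vectors induced by a
symplectic matrix, given the transformation law of the alternating form `p dqᵀ - q dpᵀ`. -/
theorem esjMetric_eq_of_mobius (hac : aᵀ * c = cᵀ * a) (hbd : bᵀ * d = dᵀ * b)
    (had : aᵀ * d - cᵀ * b = 1) (hda : dᵀ * a - bᵀ * c = 1) (hx : xᵀ = x) (hy : yᵀ = y)
    (hpd : y.PosDef) {x₁ y₁ dx dy dx₁ dy₁ : Matrix (Fin n) (Fin n) ℝ}
    (hv₁ : complexMatrix x₁ y₁ = mobius (a.map Complex.ofReal) (b.map Complex.ofReal)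
      (c.map Complex.ofReal) (d.map Complex.ofReal) (complexMatrix x y))
    (hw₁ : complexMatrix dx₁ dy₁ = ((automorphyFactor c d x y)⁻¹)ᵀ * complexMatrix dx dy *
      (automorphyFactor c d x y)⁻¹)
    {p q p₁ q₁ dp dq : Matrix (Fin 1) (Fin n) ℝ} {dκ dκ₁ : ℝ}
    (hκ : dκ₁ - (p₁ * (-(dp * bᵀ) + dq * aᵀ)ᵀ) 0 0 + (q₁ * (dp * dᵀ - dq * cᵀ)ᵀ) 0 0 =
      dκ - (p * dqᵀ) 0 0 + (q * dpᵀ) 0 0) (α γ δ : ℝ) :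
    esjMetric n α γ δ x₁ y₁ dx₁ dy₁ p₁ q₁ (dp * dᵀ - dq * cᵀ) (-(dp * bᵀ) + dq * aᵀ) dκ₁ =
      esjMetric n α γ δ x y dx dy p q dp dq dκ := by
  obtain ⟨hAC, hBD, hAD, hDA⟩ := map_ofReal_symplectic hac hbd had hda
  have hU := isUnit_automorphyFactor hac hbd had hda hx hy hpd
  have hU' : IsUnit (automorphyFactor c d x (-y)) := by
    rw [← map_conj_automorphyFactor]
    exact hU.map (starRingEnd ℂ).mapMatrix
  have hv : (complexMatrix x y)ᵀ = complexMatrix x y := by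
    rw [transpose_complexMatrix, hx, hy]
  have hv₁t : (complexMatrix x₁ y₁)ᵀ = complexMatrix x₁ y₁ := by
    rw [hv₁]
    exact mobius_transpose hAC hBD hAD hDA hv hU
  have hx₁ : x₁ᵀ = x₁ := by
    simpa only [transpose_complexMatrix, map_re_complexMatrix] using
      congrArg (Matrix.map · Complex.re) hv₁t
  have hy₁ : y₁ᵀ = y₁ := by
    simpa only [transpose_complexMatrix, map_im_complexMatrix] using
      congrArg (Matrix.map · Complex.im) hv₁t
  have hinv : (automorphyFactor c d x y)⁻¹.map (starRingEnd ℂ) =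
      (automorphyFactor c d x (-y))⁻¹ := by
    rw [map_inv_of_isUnit _ hU, map_conj_automorphyFactor]
  have hv₁' : complexMatrix x₁ (-y₁) = mobius (a.map Complex.ofReal) (b.map Complex.ofReal)
      (c.map Complex.ofReal) (d.map Complex.ofReal) (complexMatrix x (-y)) := by
    rw [← map_conj_complexMatrix, hv₁]
    change (automorphyFactor a b x y * (automorphyFactor c d x y)⁻¹).map (starRingEnd ℂ) =
      automorphyFactor a b x (-y) * (automorphyFactor c d x (-y))⁻¹
    rw [Matrix.map_mul, map_conj_automorphyFactor, hinv]
  have hw₁' : complexMatrix dx₁ (-dy₁) = ((automorphyFactor c d x (-y))⁻¹)ᵀ *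
      complexMatrix dx (-dy) * (automorphyFactor c d x (-y))⁻¹ := by
    rw [← map_conj_complexMatrix, hw₁, Matrix.map_mul, Matrix.map_mul, transpose_map, hinv,
      map_conj_complexMatrix]
  have hrow := row_mul_mobius_add hAC hBD hAD hDA hU (dp.map Complex.ofReal)
    (dq.map Complex.ofReal)
  have hrow' := row_mul_mobius_add hAC hBD hAD hDA hU' (dp.map Complex.ofReal)
    (dq.map Complex.ofReal)
  have hsub := mobius_sub hAC hBD hAD hDA hv hU hU'
  rw [← hv₁, ← hv₁', hv₁t, complexMatrix_sub_neg, complexMatrix_sub_neg, Matrix.mul_smul,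
    Matrix.smul_mul, smul_right_inj (by simp)] at hsub
  rw [← hv₁] at hrow
  rw [← hv₁'] at hrow'
  rw [← automorphyFactor] at hrow hrow'
  rw [← automorphyFactor, ← automorphyFactor] at hsub
  have hyu : IsUnit y := hpd.isUnit
  have hYu : IsUnit (y.map Complex.ofReal) := hyu.map Complex.ofRealHom.mapMatrix
  generalize automorphyFactor c d x y = U at *
  generalize automorphyFactor c d x (-y) = U' at *
  rw [Matrix.isUnit_iff_isUnit_det] at hU hU'
  have hy₁u : IsUnit y₁ := by
    have h : IsUnit (y₁.map Complex.ofReal) := by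
      rw [hsub, Matrix.isUnit_iff_isUnit_det, det_mul, det_mul, det_transpose]
      exact ((isUnit_nonsing_inv_det _ hU).mul ((Matrix.isUnit_iff_isUnit_det _).1 hYu)).mul
        (isUnit_nonsing_inv_det _ hU')
    rw [Matrix.isUnit_iff_isUnit_det] at h ⊢
    have hdet : (y₁.map Complex.ofReal).det = (y₁.det : ℂ) :=
      (RingHom.map_det Complex.ofRealHom y₁).symm
    rw [hdet, isUnit_iff_ne_zero] at h
    exact isUnit_iff_ne_zero.2 (by exact_mod_cast h)
  have hYinv : (y₁.map Complex.ofReal)⁻¹ = U' * (y.map Complex.ofReal)⁻¹ * Uᵀ := by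
    rw [hsub, Matrix.mul_inv_rev, Matrix.mul_inv_rev, ← transpose_nonsing_inv,
      nonsing_inv_nonsing_inv _ hU, nonsing_inv_nonsing_inv _ hU', Matrix.mul_assoc]
  have hYt (z : Matrix (Fin n) (Fin n) ℝ) (hz : zᵀ = z) :
      ((z.map Complex.ofReal)⁻¹)ᵀ = (z.map Complex.ofReal)⁻¹ := by
    rw [transpose_nonsing_inv, ← transpose_map, hz]
  have hYinv' : (y₁.map Complex.ofReal)⁻¹ = U * (y.map Complex.ofReal)⁻¹ * U'ᵀ := by
    rw [← hYt y₁ hy₁, hYinv]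
    simp only [transpose_mul, transpose_transpose, hYt y hy, Matrix.mul_assoc]
  have hcancel {k : Type} (V : Matrix (Fin n) (Fin n) ℂ) (hV : IsUnit V.det)
      (M : Matrix (Fin n) k ℂ) : V⁻¹ * (V * M) = M ∧ Vᵀ * ((V⁻¹)ᵀ * M) = M := by
    rw [← Matrix.mul_assoc, ← Matrix.mul_assoc, ← transpose_mul, Matrix.nonsing_inv_mul _ hV,
      transpose_one, Matrix.one_mul]
    exact ⟨rfl, rfl⟩
  have htrace : ((y₁.map Complex.ofReal)⁻¹ * complexMatrix dx₁ dy₁ *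
        ((y₁.map Complex.ofReal)⁻¹ * complexMatrix dx₁ (-dy₁))).trace =
      ((y.map Complex.ofReal)⁻¹ * complexMatrix dx dy *
        ((y.map Complex.ofReal)⁻¹ * complexMatrix dx (-dy))).trace := by
    nth_rewrite 1 [hYinv]
    rw [hYinv', hw₁, hw₁']
    simp only [Matrix.mul_assoc, (hcancel U hU _).1, (hcancel U hU _).2, (hcancel U' hU' _).2]
    rw [Matrix.trace_mul_comm]
    simp only [Matrix.mul_assoc, Matrix.nonsing_inv_mul _ hU', Matrix.mul_one]
  apply Complex.ofReal_injective
  rw [ofReal_esjMetric hx₁ hy₁ hy₁u, ofReal_esjMetric hx hy hyu, htrace, hκ]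
  simp only [map_ofReal_add, map_ofReal_sub, map_ofReal_neg, map_ofReal_mul, transpose_map]
  rw [hrow, hrow', hYinv']
  simp only [transpose_mul, Matrix.mul_assoc, (hcancel U hU _).1, (hcancel U' hU' _).2]

end Metric

theorem symplectic_block_relations {n : ℕ} {a b c d : Matrix (Fin n) (Fin n) ℝ}
    (hM : (fromBlocks a b c d)ᵀ * Jmat n * fromBlocks a b c d = Jmat n) :
    aᵀ * c = cᵀ * a ∧ bᵀ * d = dᵀ * b ∧ aᵀ * d - cᵀ * b = 1 ∧ dᵀ * a - bᵀ * c = 1 := by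
  rw [Jmat, fromBlocks_transpose, fromBlocks_multiply, fromBlocks_multiply, fromBlocks_inj] at hM
  simp only [mul_zero, mul_one, mul_neg, neg_mul, zero_add, add_zero] at hM
  obtain ⟨h1, h2, h3, h4⟩ := hM
  refine ⟨?_, ?_, ?_, ?_⟩
  · rwa [neg_add_eq_zero, eq_comm] at h1
  · rwa [neg_add_eq_zero, eq_comm] at h4
  · rwa [neg_add_eq_sub] at h2
  · rw [← neg_inj, ← h3]
    abel

theorem mderiv_eq_of_hasDerivAt {m k : Type*} {f : ℝ → Matrix m k ℝ} {f' : Matrix m k ℝ} {t : ℝ}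
    (h : ∀ i j, HasDerivAt (fun s => f s i j) (f' i j) t) : mderiv f t = f' := by
  ext i j
  exact (h i j).deriv

theorem hasDerivAt_mderiv {m k : Type*} {f : ℝ → Matrix m k ℝ}
    (h : ∀ i j, Differentiable ℝ fun s => f s i j) (t : ℝ) (i : m) (j : k) :
    HasDerivAt (fun s => f s i j) (mderiv f t i j) t :=
  (h i j t).hasDerivAt

theorem hasDerivAt_mul_const_apply {m l k : Type*} [Fintype l] {f : ℝ → Matrix m l ℝ}
    {f' : Matrix m l ℝ} {t : ℝ} (h : ∀ i j, HasDerivAt (fun s => f s i j) (f' i j) t)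
    (M : Matrix l k ℝ) (i : m) (j : k) :
    HasDerivAt (fun s => (f s * M) i j) ((f' * M) i j) t := by
  simp only [Matrix.mul_apply]
  exact HasDerivAt.fun_sum fun r _ => (h i r).mul_const (M r j)

theorem alternating_form_invariant {m n R : Type*} [Fintype n] [DecidableEq n] [CommRing R]
    {a b c d : Matrix n n R} (hac : aᵀ * c = cᵀ * a) (hbd : bᵀ * d = dᵀ * b)
    (had : aᵀ * d - cᵀ * b = 1) (hda : dᵀ * a - bᵀ * c = 1) (p q r s : Matrix m n R) :
    (p * dᵀ - q * cᵀ) * (-(r * bᵀ) + s * aᵀ)ᵀ - (-(p * bᵀ) + q * aᵀ) * (r * dᵀ - s * cᵀ)ᵀ =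
      p * sᵀ - q * rᵀ := by
  have h : (p * dᵀ - q * cᵀ) * (-(r * bᵀ) + s * aᵀ)ᵀ -
      (-(p * bᵀ) + q * aᵀ) * (r * dᵀ - s * cᵀ)ᵀ =
        p * ((dᵀ * a - bᵀ * c) * sᵀ) - q * ((aᵀ * d - cᵀ * b) * rᵀ) +
          p * ((bᵀ * d - dᵀ * b) * rᵀ) + q * ((aᵀ * c - cᵀ * a) * sᵀ) := by
    simp only [transpose_add, transpose_sub, transpose_neg, transpose_mul, transpose_transpose,
      Matrix.mul_add, Matrix.add_mul, Matrix.mul_sub, Matrix.sub_mul, Matrix.neg_mul,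
      Matrix.mul_neg, Matrix.mul_assoc]
    abel
  rw [h, hac, hbd, had, hda]
  simp

/-- Invariance of the three-parameter metric on the extended Siegel–Jacobi upper half
space `𝒳̃^J_n` under the action of the real Jacobi group. -/
theorem esjMetric_invariant (n : ℕ) (α γ δ : ℝ) (hα : 0 < α) (hγ : 0 < γ) (hδ : 0 < δ)
    (a b c d : Matrix (Fin n) (Fin n) ℝ)
    (hM : (fromBlocks a b c d)ᵀ * Jmat n * fromBlocks a b c d = Jmat n)
    (lam mu : Matrix (Fin 1) (Fin n) ℝ) (κ : ℝ)
    (x' y' : ℝ → Matrix (Fin n) (Fin n) ℝ)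
    (hx'symm : ∀ t, (x' t)ᵀ = x' t) (hy'symm : ∀ t, (y' t)ᵀ = y' t)
    (hy'pd : ∀ t, (y' t).PosDef)
    (hx' : ∀ i j, Differentiable ℝ fun t => x' t i j)
    (hy' : ∀ i j, Differentiable ℝ fun t => y' t i j)
    (p' q' : ℝ → Matrix (Fin 1) (Fin n) ℝ)
    (hp' : ∀ i j, Differentiable ℝ fun t => p' t i j)
    (hq' : ∀ i j, Differentiable ℝ fun t => q' t i j)
    (κ' : ℝ → ℝ) (hκ' : Differentiable ℝ κ') (t : ℝ) :
    letI p := lam * dᵀ - mu * cᵀ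
    letI q := -(lam * bᵀ) + mu * aᵀ
    letI v₁ : ℝ → Matrix (Fin n) (Fin n) ℂ := fun s =>
      (a.map Complex.ofReal *
          ((x' s).map Complex.ofReal + Complex.I • (y' s).map Complex.ofReal) +
        b.map Complex.ofReal) *
      (c.map Complex.ofReal *
          ((x' s).map Complex.ofReal + Complex.I • (y' s).map Complex.ofReal) +
        d.map Complex.ofReal)⁻¹
    letI x₁ : ℝ → Matrix (Fin n) (Fin n) ℝ := fun s => (v₁ s).map Complex.re
    letI y₁ : ℝ → Matrix (Fin n) (Fin n) ℝ := fun s => (v₁ s).map Complex.im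
    letI p₁ : ℝ → Matrix (Fin 1) (Fin n) ℝ := fun s => p + p' s * dᵀ - q' s * cᵀ
    letI q₁ : ℝ → Matrix (Fin 1) (Fin n) ℝ := fun s => q - p' s * bᵀ + q' s * aᵀ
    letI κ₁ : ℝ → ℝ := fun s =>
      κ + κ' s + (lam * (q' s)ᵀ) 0 0 - (mu * (p' s)ᵀ) 0 0
    esjMetric n α γ δ (x₁ t) (y₁ t) (mderiv x₁ t) (mderiv y₁ t)
        (p₁ t) (q₁ t) (mderiv p₁ t) (mderiv q₁ t) (deriv κ₁ t) =
      esjMetric n α γ δ (x' t) (y' t) (mderiv x' t) (mderiv y' t)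
        (p' t) (q' t) (mderiv p' t) (mderiv q' t) (deriv κ' t) := by
  obtain ⟨hac, hbd, had, hda⟩ := symplectic_block_relations hM
  obtain ⟨hAC, hBD, hAD, hDA⟩ := map_ofReal_symplectic hac hbd had hda
  let v₁ : ℝ → Matrix (Fin n) (Fin n) ℂ := fun s =>
    mobius (a.map Complex.ofReal) (b.map Complex.ofReal) (c.map Complex.ofReal)
      (d.map Complex.ofReal) (complexMatrix (x' s) (y' s))
  let x₁ : ℝ → Matrix (Fin n) (Fin n) ℝ := fun s => (v₁ s).map Complex.re
  let y₁ : ℝ → Matrix (Fin n) (Fin n) ℝ := fun s => (v₁ s).map Complex.im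
  let p := lam * dᵀ - mu * cᵀ
  let q := -(lam * bᵀ) + mu * aᵀ
  let p₁ : ℝ → Matrix (Fin 1) (Fin n) ℝ := fun s => p + p' s * dᵀ - q' s * cᵀ
  let q₁ : ℝ → Matrix (Fin 1) (Fin n) ℝ := fun s => q - p' s * bᵀ + q' s * aᵀ
  let κ₁ : ℝ → ℝ := fun s => κ + κ' s + (lam * (q' s)ᵀ) 0 0 - (mu * (p' s)ᵀ) 0 0
  change esjMetric n α γ δ (x₁ t) (y₁ t) (mderiv x₁ t) (mderiv y₁ t)
    (p₁ t) (q₁ t) (mderiv p₁ t) (mderiv q₁ t) (deriv κ₁ t) = _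
  have hp := hasDerivAt_mderiv hp' t
  have hq := hasDerivAt_mderiv hq' t
  have hdp : mderiv p₁ t = mderiv p' t * dᵀ - mderiv q' t * cᵀ :=
    mderiv_eq_of_hasDerivAt fun i j => ((hasDerivAt_mul_const_apply hp dᵀ i j).const_add
      (p i j)).sub (hasDerivAt_mul_const_apply hq cᵀ i j)
  have hdq : mderiv q₁ t = -(mderiv p' t * bᵀ) + mderiv q' t * aᵀ :=
    mderiv_eq_of_hasDerivAt fun i j => (((hasDerivAt_mul_const_apply hp bᵀ i j).const_sub
      (q i j))).add (hasDerivAt_mul_const_apply hq aᵀ i j)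
  have hpair (r : Matrix (Fin 1) (Fin n) ℝ) {f : ℝ → Matrix (Fin 1) (Fin n) ℝ}
      {f' : Matrix (Fin 1) (Fin n) ℝ} (h : ∀ i j, HasDerivAt (fun s => f s i j) (f' i j) t) :
      HasDerivAt (fun s => (r * (f s)ᵀ) 0 0) ((r * f'ᵀ) 0 0) t := by
    have hcomm (g : Matrix (Fin 1) (Fin n) ℝ) : (r * gᵀ) 0 0 = (g * rᵀ) 0 0 := by
      rw [← transpose_apply (r * gᵀ), transpose_mul, transpose_transpose]
    simpa only [hcomm] using hasDerivAt_mul_const_apply h rᵀ 0 0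
  have hdκ : deriv κ₁ t =
      deriv κ' t + (lam * (mderiv q' t)ᵀ) 0 0 - (mu * (mderiv p' t)ᵀ) 0 0 :=
    ((((hκ' t).hasDerivAt.const_add κ).add (hpair lam hq)).sub (hpair mu hp)).deriv
  have hU := isUnit_automorphyFactor hac hbd had hda (hx'symm t) (hy'symm t) (hy'pd t)
  have hv (i j : Fin n) : HasDerivAt (fun s => complexMatrix (x' s) (y' s) i j)
      (complexMatrix (mderiv x' t) (mderiv y' t) i j) t :=
    (hasDerivAt_mderiv hx' t i j).ofReal_comp.add
      ((hasDerivAt_mderiv hy' t i j).ofReal_comp.const_mul Complex.I)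
  have hdv := hasDerivAt_mobius (A := a.map Complex.ofReal) (B := b.map Complex.ofReal) hv hU
  have hvt : (complexMatrix (x' t) (y' t))ᵀ = complexMatrix (x' t) (y' t) := by
    rw [transpose_complexMatrix, hx'symm, hy'symm]
  have hw := sub_mobius_mul hAC hBD hAD hDA hvt hU
  rw [mobius] at hw
  rw [hw] at hdv
  have hdx : mderiv x₁ t = _ := mderiv_eq_of_hasDerivAt (f' := Matrix.map _ Complex.re)
    fun i j => Complex.reCLM.hasFDerivAt.comp_hasDerivAt t (hdv i j)
  have hdy : mderiv y₁ t = _ := mderiv_eq_of_hasDerivAt (f' := Matrix.map _ Complex.im)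
    fun i j => Complex.imCLM.hasFDerivAt.comp_hasDerivAt t (hdv i j)
  rw [hdp, hdq]
  refine esjMetric_eq_of_mobius hac hbd had hda (hx'symm t) (hy'symm t) (hy'pd t)
    (complexMatrix_re_im _) ?_ ?_ α γ δ
  · rw [hdx, hdy]
    exact complexMatrix_re_im _
  · have hp₁ : p₁ t = (lam + p' t) * dᵀ - (mu + q' t) * cᵀ := by
      simp only [p₁, p, Matrix.add_mul]
      abel
    have hq₁ : q₁ t = -((lam + p' t) * bᵀ) + (mu + q' t) * aᵀ := by
      simp only [q₁, q, Matrix.add_mul]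
      abel
    have h := congrFun₂ (alternating_form_invariant hac hbd had hda (lam + p' t) (mu + q' t)
      (mderiv p' t) (mderiv q' t)) 0 0
    rw [← hp₁, ← hq₁] at h
    simp only [Matrix.add_mul, Matrix.sub_apply, Matrix.add_apply] at h
    rw [hdκ]
    linarith
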